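/- arXiv:2406.14153 — 2 statements merged into one kernel-verified Lean document; each statement's English description precedes it below -/
import Mathlib

section
/- Let C₄ = K_{2,2} be the cycle graph on vertices {1,2,3,4} with edges {1,2},{2,3},{3,4},{1,4}. For t ∈ (0,1), let L_t := {q ∈ ℝ^{E(C₄)} : ((t,t,t,t), q) ∈ COR(C₄)} and N_t := {q : max(0,2t−1) ≤ q(e) ≤ t for every edge e}, so that vol(N_t) = min(t,1−t)⁴. Then vol(L_t)/vol(N_t) equals: 5/6 for t ∈ (0,1/3]; (5 − (3−1/t)⁴)/6 for t ∈ (1/3,1/2]; (5 − (3−1/(1−t))⁴)/6 for t ∈ (1/2,2/3]; and 5/6 for t ∈ (2/3,1). In particular the ratio is constant equal to 5/6 on (0,1/3] and equals 2/3 at t = 1/2. -/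
open MeasureTheory

noncomputable section

/-- The extremal point of the correlation polytope associated to a 0/1 assignment. -/
def corPoint {V : Type} (G : SimpleGraph V) (f : V → Bool) :
    (V → ℝ) × (G.edgeSet → ℝ) :=
  (fun i => if f i then 1 else 0,
   fun e => Sym2.lift ⟨fun i j => (if f i then (1 : ℝ) else 0) * (if f j then 1 else 0),
     fun _ _ => mul_comm _ _⟩ e.1)

/-- The correlation polytope `COR(G)` of a graph `G`. -/
def cor {V : Type} (G : SimpleGraph V) : Set ((V → ℝ) × (G.edgeSet → ℝ)) :=
  convexHull ℝ (Set.range (corPoint G))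

/-- The square graph `C₄ = K_{2,2}`: the cycle graph on four vertices. -/
def C4 : SimpleGraph (Fin 4) := SimpleGraph.cycleGraph 4

instance : DecidableRel C4.Adj :=
  inferInstanceAs (DecidableRel (SimpleGraph.cycleGraph 4).Adj)

/-- The symmetric slice of the local polytope of the square graph at marginal `t`. -/
def L4 (t : ℝ) : Set (C4.edgeSet → ℝ) := {q | ((fun _ => t), q) ∈ cor C4}

/-- The edge `{i, i+1}` of the square. -/
def edgeC4 (i : Fin 4) : C4.edgeSet := ⟨s(i, i + 1), by
  rw [SimpleGraph.mem_edgeSet]; revert i; decide⟩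

lemma edgeC4_bij : Function.Bijective edgeC4 := by
  rw [Fintype.bijective_iff_injective_and_card]
  constructor
  · intro i j h
    have h' : s(i, i + 1) = s(j, j + 1) := congrArg Subtype.val h
    revert i j; decide
  · decide

/-- Edges of the square are indexed by `Fin 4`. -/
def edgeEquiv : Fin 4 ≃ C4.edgeSet := Equiv.ofBijective edgeC4 edgeC4_bij

/-- The inequality description. -/
def polyP (t : ℝ) : Set (Fin 4 → ℝ) :=
  {q | (∀ i, 0 ≤ q i ∧ 2 * t - 1 ≤ q i ∧ q i ≤ t) ∧
    ∀ j, (∑ i, q i) - 2 * q j ≤ 2 * t ∧ 2 * t - 1 ≤ (∑ i, q i) - 2 * q j}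

/-- Weight of an atom in the glued distribution: `c` total mass, `a`, `b` the masses of the
two events. -/
def glueW (a b c : ℝ) : Bool → Bool → ℝ
  | true, true => min a b
  | true, false => a - min a b
  | false, true => b - min a b
  | false, false => c - a - b + min a b

lemma glueW_nonneg {a b c : ℝ} (ha : 0 ≤ a) (hb : 0 ≤ b) (hac : a ≤ c) (hbc : b ≤ c)
    (x y : Bool) : 0 ≤ glueW a b c x y := by
  cases x <;> cases y <;> simp only [glueW] <;> rcases min_cases a b with h | h <;> linarith

/-- Triangle extension: mass of the atom `111`. -/
lemma triangle_exists (t u v r : ℝ) (hu : 0 ≤ u) (hut : u ≤ t) (hv : 0 ≤ v) (hvt : v ≤ t)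
    (hr : 0 ≤ r) (hrt : r ≤ t) (hu1 : 2 * t - 1 ≤ u) (hv1 : 2 * t - 1 ≤ v) (hr1 : 2 * t - 1 ≤ r)
    (h1 : u + v - t ≤ r) (h2 : u + r - v ≤ t) (h3 : v + r - u ≤ t)
    (h4 : 3 * t - 1 ≤ u + v + r) :
    ∃ m, 0 ≤ m ∧ m ≤ u ∧ m ≤ v ∧ m ≤ r ∧ u + v - t ≤ m ∧ u + r - t ≤ m ∧ v + r - t ≤ m ∧
      m ≤ 1 - 3 * t + u + v + r := by
  refine ⟨max (max 0 (u + v - t)) (max (u + r - t) (v + r - t)), ?_⟩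
  refine ⟨by simp, ?_, ?_, ?_, by simp, by simp, by simp, ?_⟩ <;>
  simp only [max_le_iff] <;> refine ⟨⟨?_, ?_⟩, ?_, ?_⟩ <;> linarith

lemma exists_r (t a b c d : ℝ) (ht0 : 0 < t) (ht1 : t < 1)
    (ha : 0 ≤ a ∧ 2 * t - 1 ≤ a ∧ a ≤ t) (hb : 0 ≤ b ∧ 2 * t - 1 ≤ b ∧ b ≤ t)
    (hc : 0 ≤ c ∧ 2 * t - 1 ≤ c ∧ c ≤ t) (hd : 0 ≤ d ∧ 2 * t - 1 ≤ d ∧ d ≤ t)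
    (h1 : b + c + d - a ≤ 2 * t ∧ 2 * t - 1 ≤ b + c + d - a)
    (h2 : a + c + d - b ≤ 2 * t ∧ 2 * t - 1 ≤ a + c + d - b)
    (h3 : a + b + d - c ≤ 2 * t ∧ 2 * t - 1 ≤ a + b + d - c)
    (h4 : a + b + c - d ≤ 2 * t ∧ 2 * t - 1 ≤ a + b + c - d) :
    ∃ r, 0 ≤ r ∧ r ≤ t ∧ 2 * t - 1 ≤ r ∧ a + b - t ≤ r ∧ a + r - b ≤ t ∧ b + r - a ≤ t ∧
      3 * t - 1 ≤ a + b + r ∧ c + d - t ≤ r ∧ c + r - d ≤ t ∧ d + r - c ≤ t ∧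
      3 * t - 1 ≤ c + d + r := by
  obtain ⟨r, hr⟩ : ∃ r, r = max (max (max 0 (2 * t - 1)) (max (a + b - t) (3 * t - 1 - a - b)))
    (max (c + d - t) (3 * t - 1 - c - d)) := ⟨_, rfl⟩
  have key : ∀ z, r ≤ z ↔ ((0 ≤ z ∧ 2 * t - 1 ≤ z) ∧ a + b - t ≤ z ∧ 3 * t - 1 - a - b ≤ z) ∧
      c + d - t ≤ z ∧ 3 * t - 1 - c - d ≤ z := by
    intro z; rw [hr]; simp only [max_le_iff]
  obtain ⟨⟨⟨k1, k2⟩, k3, k4⟩, k5, k6⟩ := (key r).1 le_rfl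
  have l0 : r ≤ t := by rw [key]; refine ⟨⟨⟨?_, ?_⟩, ?_, ?_⟩, ?_, ?_⟩ <;> linarith
  have l1 : r ≤ t + b - a := by rw [key]; refine ⟨⟨⟨?_, ?_⟩, ?_, ?_⟩, ?_, ?_⟩ <;> linarith
  have l2 : r ≤ t + a - b := by rw [key]; refine ⟨⟨⟨?_, ?_⟩, ?_, ?_⟩, ?_, ?_⟩ <;> linarith
  have l3 : r ≤ t + d - c := by rw [key]; refine ⟨⟨⟨?_, ?_⟩, ?_, ?_⟩, ?_, ?_⟩ <;> linarith
  have l4 : r ≤ t + c - d := by rw [key]; refine ⟨⟨⟨?_, ?_⟩, ?_, ?_⟩, ?_, ?_⟩ <;> linarith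
  refine ⟨r, ?_, ?_, ?_, ?_, ?_, ?_, ?_, ?_, ?_, ?_, ?_⟩ <;> linarith

lemma L4_sub (t : ℝ) (q : C4.edgeSet → ℝ) (h : q ∈ L4 t) :
    (fun i => q (edgeEquiv i)) ∈ polyP t := by
  let K : Set ((Fin 4 → ℝ) × (C4.edgeSet → ℝ)) :=
    {p | (∀ i : Fin 4, 0 ≤ p.2 (edgeC4 i) ∧ p.1 i + p.1 (i + 1) - 1 ≤ p.2 (edgeC4 i) ∧
        p.2 (edgeC4 i) ≤ p.1 i) ∧
      ∀ j : Fin 4, (∑ i, p.2 (edgeC4 i)) - 2 * p.2 (edgeC4 j) ≤ p.1 (j + 2) + p.1 (j + 3) ∧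
        p.1 (j + 2) + p.1 (j + 3) - 1 ≤ (∑ i, p.2 (edgeC4 i)) - 2 * p.2 (edgeC4 j)}
  have hK : Convex ℝ K := by
    intro p hp p' hp' a b ha hb hab
    have hb' : b = 1 - a := by linarith
    obtain ⟨h1, h2⟩ := hp
    obtain ⟨h1', h2'⟩ := hp'
    simp only [Fin.sum_univ_four] at h2 h2'
    refine ⟨fun i => ?_, fun j => ?_⟩
    · obtain ⟨x1, x2, x3⟩ := h1 i
      obtain ⟨y1, y2, y3⟩ := h1' i
      simp only [Prod.fst_add, Prod.snd_add, Prod.smul_fst, Prod.smul_snd, Pi.add_apply,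
        Pi.smul_apply, smul_eq_mul]
      refine ⟨by positivity, ?_, ?_⟩
      · have := mul_le_mul_of_nonneg_left x2 ha
        have := mul_le_mul_of_nonneg_left y2 hb
        linarith
      · have := mul_le_mul_of_nonneg_left x3 ha
        have := mul_le_mul_of_nonneg_left y3 hb
        linarith
    · obtain ⟨x1, x2⟩ := h2 j
      obtain ⟨y1, y2⟩ := h2' j
      simp only [Prod.fst_add, Prod.snd_add, Prod.smul_fst, Prod.smul_snd, Pi.add_apply,
        Pi.smul_apply, smul_eq_mul, Fin.sum_univ_four]
      constructor
      · have := mul_le_mul_of_nonneg_left x1 ha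
        have := mul_le_mul_of_nonneg_left y1 hb
        linarith
      · have := mul_le_mul_of_nonneg_left x2 ha
        have := mul_le_mul_of_nonneg_left y2 hb
        linarith
  have hsub : cor C4 ⊆ K := by
    apply convexHull_min _ hK
    rintro _ ⟨f, rfl⟩
    refine ⟨fun i => ?_, fun j => ?_⟩
    · simp only [corPoint, edgeC4, Sym2.lift_mk]
      cases f i <;> cases f (i + 1) <;> norm_num
    · have e1 : ∀ j : Fin 4, j = 0 ∨ j = 1 ∨ j = 2 ∨ j = 3 := by decide
      simp only [corPoint, edgeC4, Sym2.lift_mk, Fin.sum_univ_four]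
      have a1 : (0 : Fin 4) + 1 = 1 := rfl
      have a2 : (1 : Fin 4) + 1 = 2 := rfl
      have a3 : (2 : Fin 4) + 1 = 3 := rfl
      have a4 : (3 : Fin 4) + 1 = 0 := rfl
      have b1 : (0 : Fin 4) + 2 = 2 := rfl
      have b2 : (1 : Fin 4) + 2 = 3 := rfl
      have b3 : (2 : Fin 4) + 2 = 0 := rfl
      have b4 : (3 : Fin 4) + 2 = 1 := rfl
      have c1 : (0 : Fin 4) + 3 = 3 := rfl
      have c2 : (1 : Fin 4) + 3 = 0 := rfl
      have c3 : (2 : Fin 4) + 3 = 1 := rfl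
      have c4 : (3 : Fin 4) + 3 = 2 := rfl
      rcases e1 j with rfl | rfl | rfl | rfl <;>
      simp only [a1, a2, a3, a4, b1, b2, b3, b4, c1, c2, c3, c4] <;>
      cases f 0 <;> cases f 1 <;> cases f 2 <;> cases f 3 <;> norm_num
  obtain ⟨h1, h2⟩ := hsub h
  refine ⟨fun i => ?_, fun j => ?_⟩
  · obtain ⟨x1, x2, x3⟩ := h1 i
    simp only [] at x1 x2 x3
    exact ⟨x1, by change _ ≤ q (edgeC4 i); linarith, x3⟩
  · obtain ⟨x1, x2⟩ := h2 j
    simp only [] at x1 x2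
    change (∑ i, q (edgeC4 i)) - 2 * q (edgeC4 j) ≤ _ ∧ _ ≤ (∑ i, q (edgeC4 i)) - 2 * q (edgeC4 j)
    constructor <;> linarith

/-- Mass of the marginal atom on vertices `0, 2`. -/
def margW (t r : ℝ) : Bool → Bool → ℝ
  | true, true => r
  | true, false => t - r
  | false, true => t - r
  | false, false => 1 - 2 * t + r

/-- Mass of the atoms with the middle vertex equal to one. -/
def triW (t u v r m : ℝ) : Bool → Bool → ℝ
  | true, true => m
  | true, false => u - m
  | false, true => v - m
  | false, false => t - u - v + m

lemma L4_sup (t : ℝ) (ht0 : 0 < t) (ht1 : t < 1) (q : C4.edgeSet → ℝ)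
    (h : (fun i => q (edgeEquiv i)) ∈ polyP t) : q ∈ L4 t := by
  obtain ⟨h1, h2⟩ := h
  simp only [Fin.sum_univ_four] at h2
  -- a = q01, b = q12, c = q23, d = q30
  obtain ⟨a, ha⟩ : ∃ a, a = q (edgeEquiv 0) := ⟨_, rfl⟩
  obtain ⟨b, hb⟩ : ∃ a, a = q (edgeEquiv 1) := ⟨_, rfl⟩
  obtain ⟨c, hc⟩ : ∃ a, a = q (edgeEquiv 2) := ⟨_, rfl⟩
  obtain ⟨d, hd⟩ : ∃ a, a = q (edgeEquiv 3) := ⟨_, rfl⟩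
  have i0 := h1 0
  have i1 := h1 1
  have i2 := h1 2
  have i3 := h1 3
  have j0 := h2 0
  have j1 := h2 1
  have j2 := h2 2
  have j3 := h2 3
  simp only [← ha, ← hb, ← hc, ← hd] at i0 i1 i2 i3 j0 j1 j2 j3
  obtain ⟨r, r1, r2, r3, r4, r5, r6, r7, r8, r9, r10, r11⟩ := exists_r t a b c d ht0 ht1 i0 i1 i2 i3
    ⟨by linarith, by linarith⟩ ⟨by linarith, by linarith⟩ ⟨by linarith, by linarith⟩
    ⟨by linarith, by linarith⟩
  obtain ⟨m, m1, m2, m3, m4, m5, m6, m7, m8⟩ := triangle_exists t a b r i0.1 i0.2.2 i1.1 i1.2.2 r1 r2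
    i0.2.1 i1.2.1 r3 r4 r5 r6 r7
  obtain ⟨n, n1, n2, n3, n4, n5, n6, n7, n8⟩ := triangle_exists t d c r i3.1 i3.2.2 i2.1 i2.2.2 r1 r2
    i3.2.1 i2.2.1 r3 (by linarith) (by linarith) (by linarith) (by linarith)
  let w : Bool × Bool × Bool × Bool → ℝ := fun x =>
    glueW (triW t a b r m x.1 x.2.2.1) (triW t d c r n x.1 x.2.2.1) (margW t r x.1 x.2.2.1)
      x.2.1 x.2.2.2
  have hw : ∀ x, 0 ≤ w x := by
    rintro ⟨x0, x1, x2, x3⟩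
    apply glueW_nonneg <;> cases x0 <;> cases x2 <;> simp only [triW, margW] <;> linarith
  have hw1 : ∑ x, w x = 1 := by
    simp only [Fintype.sum_prod_type, Fintype.sum_bool, w, glueW, triW, margW]
    ring
  have hmem : ∑ x, w x • corPoint C4 ![x.1, x.2.1, x.2.2.1, x.2.2.2] ∈ cor C4 :=
    (convex_convexHull ℝ _).sum_mem (fun x _ => hw x) hw1
      (fun x _ => subset_convexHull ℝ _ ⟨_, rfl⟩)
  have e1 : ∀ j : Fin 4, j = 0 ∨ j = 1 ∨ j = 2 ∨ j = 3 := by decide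
  have heq : ∑ x, w x • corPoint C4 ![x.1, x.2.1, x.2.2.1, x.2.2.2] = ((fun _ => t), q) := by
    refine Prod.ext ?_ ?_
    · funext i
      rw [Prod.fst_sum, Finset.sum_apply]
      simp only [Prod.smul_fst, Pi.smul_apply, smul_eq_mul, corPoint]
      rcases e1 i with rfl | rfl | rfl | rfl <;>
      simp [Fintype.sum_prod_type, w, glueW, triW, margW] <;> ring
    · funext e
      obtain ⟨i, rfl⟩ := edgeEquiv.surjective e
      rw [Prod.snd_sum, Finset.sum_apply]
      have a4 : (3 : Fin 4) + 1 = 0 := rfl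
      have a3 : (2 : Fin 4) + 1 = 3 := rfl
      have a2 : (1 : Fin 4) + 1 = 2 := rfl
      have hE : ∀ i, edgeEquiv i = edgeC4 i := fun _ => rfl
      simp only [Prod.smul_snd, Pi.smul_apply, smul_eq_mul, corPoint]
      rcases e1 i with rfl | rfl | rfl | rfl
      · rw [← ha]
        simp [hE, edgeC4, Fintype.sum_prod_type, w, glueW, triW, margW] <;> ring
      · rw [← hb]
        simp [hE, edgeC4, a2, Fintype.sum_prod_type, w, glueW, triW, margW] <;> ring
      · rw [← hc]
        simp [hE, edgeC4, a3, Fintype.sum_prod_type, w, glueW, triW, margW] <;> ring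
      · rw [← hd]
        simp [hE, edgeC4, a4, Fintype.sum_prod_type, w, glueW, triW, margW] <;> ring
  rw [heq] at hmem
  exact hmem

lemma volume_L4 (t : ℝ) (ht0 : 0 < t) (ht1 : t < 1) : volume (L4 t) = volume (polyP t) := by
  have hmp := volume_measurePreserving_piCongrLeft (fun _ : C4.edgeSet => ℝ) edgeEquiv
  rw [← hmp.measure_preimage_equiv]
  congr 1
  ext p
  have hp : (fun i => (MeasurableEquiv.piCongrLeft (fun _ : C4.edgeSet => ℝ) edgeEquiv) p
      (edgeEquiv i)) = p := by
    funext i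
    exact Equiv.piCongrLeft_apply_apply (fun _ : C4.edgeSet => ℝ) edgeEquiv p i
  constructor
  · intro h
    have := L4_sub t _ h
    rwa [hp] at this
  · intro h
    apply L4_sup t ht0 ht1
    rwa [hp]

/-- The half-open simplex. -/
def simp4 (n : ℕ) (s : ℝ) : Set (Fin n → ℝ) := {z | (∀ i, 0 ≤ z i) ∧ ∑ i, z i < s}

lemma measurable_simp4 (n : ℕ) (s : ℝ) : MeasurableSet (simp4 n s) := by
  unfold simp4
  measurability

lemma volume_simp4 (n : ℕ) : ∀ s : ℝ, 0 < s →
    volume (simp4 n s) = ENNReal.ofReal (s ^ n / n.factorial) := by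
  induction n with
  | zero =>
    intro s hs
    have : simp4 0 s = Set.univ := by ext; simp [simp4, hs]
    rw [this, volume_pi, Measure.pi_of_empty]
    simp
  | succ n ih =>
    intro s hs
    have hmp := (volume_preserving_piFinSuccAbove (fun _ : Fin (n + 1) => ℝ) 0).symm
    rw [← hmp.measure_preimage_equiv, Measure.volume_eq_prod, Measure.prod_apply
      (hmp.measurable (measurable_simp4 _ _))]
    have hslice : ∀ x : ℝ, volume (Prod.mk x ⁻¹' (⇑(MeasurableEquiv.piFinSuccAbove
        (fun _ : Fin (n + 1) => ℝ) 0).symm ⁻¹' simp4 (n + 1) s)) =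
        (Set.Ico 0 s).indicator (fun x => ENNReal.ofReal ((s - x) ^ n / n.factorial)) x := by
      intro x
      by_cases hx : x ∈ Set.Ico 0 s
      · rw [Set.indicator_of_mem hx, ← ih (s - x) (by linarith [hx.2])]
        congr 1
        ext z
        have h0 := hx.1
        simp [simp4, MeasurableEquiv.piFinSuccAbove, Fin.forall_fin_succ, Fin.sum_univ_succ, h0,
          lt_sub_iff_add_lt']
      · rw [Set.indicator_of_notMem hx]
        convert measure_empty (μ := volume)
        rw [Set.eq_empty_iff_forall_notMem]
        intro z hz
        simp [simp4, MeasurableEquiv.piFinSuccAbove, Fin.forall_fin_succ, Fin.sum_univ_succ] at hz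
        apply hx
        have := Finset.sum_nonneg (s := Finset.univ) (fun i _ => hz.1.2 i)
        exact ⟨hz.1.1, by linarith⟩
    simp_rw [hslice]
    rw [lintegral_indicator measurableSet_Ico, ← ofReal_integral_eq_lintegral_ofReal]
    · congr 1
      rw [integral_Ico_eq_integral_Ioc, ← intervalIntegral.integral_of_le hs.le,
        intervalIntegral.integral_comp_sub_left (fun x => x ^ n / (n.factorial : ℝ))]
      simp only [intervalIntegral.integral_div, integral_pow, Nat.factorial_succ]
      push_cast
      have : (n : ℝ) + 1 ≠ 0 := by positivity
      field_simp
      simp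
    · apply ContinuousOn.integrableOn_Icc (b := s) _ |>.mono_set Set.Ico_subset_Icc_self
      fun_prop
    · refine (ae_restrict_iff' measurableSet_Ico).2 (Filter.Eventually.of_forall fun x hx => ?_)
      have : 0 ≤ s - x := by linarith [hx.2]
      simp only [Pi.zero_apply]
      positivity

/-- Coordinate reflection. -/
def refl4 (t : ℝ) (k : Fin 4 × Bool) (q : Fin 4 → ℝ) : Fin 4 → ℝ :=
  fun i => if (i = k.1) = (k.2 = false) then q i else t - q i

lemma refl4_mp (t : ℝ) (k : Fin 4 × Bool) :
    MeasurePreserving (refl4 t k) volume volume := by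
  have := volume_preserving_pi (ι := Fin 4) (α' := fun _ => ℝ) (β' := fun _ => ℝ)
    (f := fun i x => if (i = k.1) = (k.2 = false) then x else t - x) (by
      intro i
      by_cases h : (i = k.1) = (k.2 = false)
      · simp only [h, if_true]
        exact MeasurePreserving.id _
      · simp only [h, if_false]
        exact Measure.measurePreserving_sub_left volume t)
  exact this

/-- Size of the removed corners. -/
def sz (t : ℝ) : Bool → ℝ
  | false => t
  | true => 3 * t - 1

/-- Removed corners. -/
def corner (t : ℝ) (k : Fin 4 × Bool) : Set (Fin 4 → ℝ) := refl4 t k ⁻¹' simp4 4 (sz t k.2)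

lemma mem_corner_false (t : ℝ) (j : Fin 4) (q : Fin 4 → ℝ) : q ∈ corner t (j, false) ↔
    (0 ≤ q j ∧ ∀ i, i ≠ j → q i ≤ t) ∧ 2 * t < (∑ i, q i) - 2 * q j := by
  have e1 : ∀ j : Fin 4, j = 0 ∨ j = 1 ∨ j = 2 ∨ j = 3 := by decide
  simp only [corner, Set.mem_preimage, simp4, Set.mem_ofPred_eq, refl4, Fin.sum_univ_four,
    Fin.forall_fin_succ, sz]
  rcases e1 j with rfl | rfl | rfl | rfl <;> simp [Fin.ext_iff] <;>
    grind

lemma mem_corner_true (t : ℝ) (j : Fin 4) (q : Fin 4 → ℝ) : q ∈ corner t (j, true) ↔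
    (q j ≤ t ∧ ∀ i, i ≠ j → 0 ≤ q i) ∧ (∑ i, q i) - 2 * q j < 2 * t - 1 := by
  have e1 : ∀ j : Fin 4, j = 0 ∨ j = 1 ∨ j = 2 ∨ j = 3 := by decide
  simp only [corner, Set.mem_preimage, simp4, Set.mem_ofPred_eq, refl4, Fin.sum_univ_four,
    Fin.forall_fin_succ, sz]
  rcases e1 j with rfl | rfl | rfl | rfl <;> simp [Fin.ext_iff] <;>
    grind

lemma corner_sub (t : ℝ) (ht0 : 0 < t) (ht : t ≤ 1 / 2) (k : Fin 4 × Bool) :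
    corner t k ⊆ Set.Icc 0 (fun _ => t) := by
  intro q hq
  have h1 : ∀ i, 0 ≤ refl4 t k q i := hq.1
  have hs : sz t k.2 ≤ t := by cases k.2 <;> simp only [sz] <;> linarith
  have h2 : ∀ i, refl4 t k q i ≤ t := fun i =>
    (Finset.single_le_sum (fun i _ => h1 i) (Finset.mem_univ i)).trans (hq.2.le.trans hs)
  constructor <;> intro i <;> have h1 := h1 i <;> have h2 := h2 i <;>
    simp only [refl4] at h1 h2 <;> simp only [Pi.zero_apply] <;> split_ifs at h1 h2 <;> linarith

lemma corner_disj (t : ℝ) (ht0 : 0 < t) (ht : t ≤ 1 / 2) :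
    Pairwise (Function.onFun Disjoint (corner t)) := by
  intro k l hkl
  rw [Function.onFun, Set.disjoint_left]
  intro q hk hl
  have b := corner_sub t ht0 ht k hk
  have b0 := fun i => b.1 i
  have b1 := fun i => b.2 i
  simp only [Pi.zero_apply] at b0 b1
  have e1 : ∀ j : Fin 4, j = 0 ∨ j = 1 ∨ j = 2 ∨ j = 3 := by decide
  have x0 := b0 0
  have x1 := b0 1
  have x2 := b0 2
  have x3 := b0 3
  have y0 := b1 0
  have y1 := b1 1
  have y2 := b1 2
  have y3 := b1 3
  obtain ⟨i, x⟩ := k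
  obtain ⟨j, y⟩ := l
  cases x <;> cases y <;> simp only [mem_corner_false, mem_corner_true, Fin.sum_univ_four] at hk hl <;>
  replace hk := hk.2 <;> replace hl := hl.2 <;>
  rcases e1 i with rfl | rfl | rfl | rfl <;> rcases e1 j with rfl | rfl | rfl | rfl <;>
  first
  | exact hkl rfl
  | linarith

lemma polyP_eq (t : ℝ) (ht0 : 0 < t) (ht : t ≤ 1 / 2) :
    polyP t = Set.Icc 0 (fun _ => t) \ ⋃ k, corner t k := by
  ext q
  simp only [Set.mem_sdiff, Set.mem_iUnion, not_exists, Prod.forall, Bool.forall_bool,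
    mem_corner_false, mem_corner_true, polyP, Set.mem_ofPred_eq, Set.mem_Icc, Pi.le_def,
    Pi.zero_apply]
  constructor
  · rintro ⟨h1, h2⟩
    refine ⟨⟨fun i => (h1 i).1, fun i => (h1 i).2.2⟩, fun j => ⟨fun h => ?_, fun h => ?_⟩⟩
    · linarith [h.2, (h2 j).1]
    · linarith [h.2, (h2 j).2]
  · rintro ⟨⟨h1, h2⟩, h3⟩
    refine ⟨fun i => ⟨h1 i, by linarith [h1 i], h2 i⟩, fun j => ⟨?_, ?_⟩⟩
    · by_contra h
      exact (h3 j).1 ⟨⟨h1 j, fun i _ => h2 i⟩, not_le.1 h⟩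
    · by_contra h
      exact (h3 j).2 ⟨⟨h2 j, fun i _ => h1 i⟩, not_le.1 h⟩

lemma volume_corner (t : ℝ) (k : Fin 4 × Bool) :
    volume (corner t k) = ENNReal.ofReal ((max 0 (sz t k.2)) ^ 4 / 24) := by
  rw [corner, (refl4_mp t k).measure_preimage (measurable_simp4 _ _).nullMeasurableSet]
  rcases lt_or_ge 0 (sz t k.2) with h | h
  · rw [volume_simp4 _ _ h, max_eq_right h.le]
    norm_num [Nat.factorial]
  · have : simp4 4 (sz t k.2) = ∅ := by
      rw [Set.eq_empty_iff_forall_notMem]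
      intro z hz
      have := Finset.sum_nonneg (s := Finset.univ) (fun i _ => hz.1 i)
      linarith [hz.2]
    rw [this, max_eq_left h]
    simp

lemma volume_polyP (t : ℝ) (ht0 : 0 < t) (ht : t ≤ 1 / 2) :
    volume (polyP t) = ENNReal.ofReal ((5 * t ^ 4 - (max 0 (3 * t - 1)) ^ 4) / 6) := by
  have hm : ∀ k, MeasurableSet (corner t k) := fun k =>
    (refl4_mp t k).measurable (measurable_simp4 _ _)
  have hU : volume (⋃ k, corner t k) =
      ENNReal.ofReal ((t ^ 4 + (max 0 (3 * t - 1)) ^ 4) / 6) := by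
    rw [measure_iUnion (corner_disj t ht0 ht) hm, tsum_fintype]
    simp only [volume_corner]
    rw [← ENNReal.ofReal_sum_of_nonneg (fun i _ => by positivity)]
    congr 1
    simp only [Fintype.sum_prod_type, Fintype.sum_bool, sz, Fin.sum_univ_four, max_eq_right ht0.le]
    ring
  rw [polyP_eq t ht0 ht, measure_sdiff (Set.iUnion_subset (corner_sub t ht0 ht))
    (MeasurableSet.iUnion hm).nullMeasurableSet (by rw [hU]; exact ENNReal.ofReal_ne_top), hU,
    Real.volume_Icc_pi]
  simp only [Pi.zero_apply, sub_zero, Finset.prod_const, Finset.card_univ, Fintype.card_fin]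
  rw [← ENNReal.ofReal_pow ht0.le, ← ENNReal.ofReal_sub _ (by positivity)]
  congr 1
  ring

lemma polyP_symm (t : ℝ) : volume (polyP t) = volume (polyP (1 - t)) := by
  rw [← measure_preimage_add_right volume (fun _ => (1 - 2 * t : ℝ)) (polyP (1 - t))]
  congr 1
  ext q
  simp only [polyP, Set.mem_ofPred_eq, Set.mem_preimage, Pi.add_apply, Fin.sum_univ_four]
  constructor <;> rintro ⟨h1, h2⟩ <;>
    refine ⟨fun i => ⟨?_, ?_, ?_⟩, fun j => ⟨?_, ?_⟩⟩ <;>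
    first
    | linarith [(h1 i).1, (h1 i).2.1, (h1 i).2.2]
    | linarith [(h2 j).1, (h2 j).2]

/-- The volume ratio `vol(L_t)/vol(N_t)` for the square graph `C₄ = K_{2,2}` with symmetric
marginals `(t,t,t,t)`: since `vol(N_t) = min(t, 1-t)⁴`, the claim is that `vol(L_t)` equals
the stated piecewise ratio times `min(t, 1-t)⁴`.  In particular the ratio is `5/6` on
`(0, 1/3]` and `2/3` at `t = 1/2`. -/
theorem stmt7 (t : ℝ) (ht0 : 0 < t) (ht1 : t < 1) :
    volume (L4 t) =
      ENNReal.ofReal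
        ((if t ≤ 1 / 3 then 5 / 6
          else if t ≤ 1 / 2 then (5 - (3 - 1 / t) ^ 4) / 6
          else if t ≤ 2 / 3 then (5 - (3 - 1 / (1 - t)) ^ 4) / 6
          else 5 / 6) * min t (1 - t) ^ 4) := by
  rw [volume_L4 t ht0 ht1]
  have key : ∀ s : ℝ, 0 < s → (5 - (3 - 1 / s) ^ 4) / 6 * s ^ 4 =
      (5 * s ^ 4 - (3 * s - 1) ^ 4) / 6 := by
    intro s hs
    have : (3 - 1 / s) = (3 * s - 1) / s := by field_simp
    rw [this, div_pow]
    field_simp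
  by_cases h2 : t ≤ 1 / 2
  · rw [volume_polyP t ht0 h2, min_eq_left (by linarith)]
    congr 1
    by_cases h3 : t ≤ 1 / 3
    · rw [if_pos h3, max_eq_left (by linarith)]
      ring
    · rw [if_neg h3, if_pos h2, key t ht0, max_eq_right (by linarith)]
  · have h2' := not_le.1 h2
    rw [polyP_symm, volume_polyP (1 - t) (by linarith) (by linarith), min_eq_right (by linarith),
      if_neg (by linarith), if_neg h2]
    congr 1
    by_cases h3 : t ≤ 2 / 3
    · rw [if_pos h3, key (1 - t) (by linarith), max_eq_right (by linarith)]
    · rw [if_neg h3, max_eq_left (by linarith)]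
      ring
end
end

section
/- Let n ≥ 3 and let C_n be the cycle graph on vertex set ℤ/nℤ, with i adjacent to i+1. For t ∈ (0,1], let L_t := {q ∈ ℝ^{E(C_n)} : (t·𝟙, q) ∈ COR(C_n)}, where t·𝟙 is the constant function t on vertices. Then: (a) for every t ∈ (0,1/3], vol(L_t) = (1 − 1/(n−1)!) · t^n; and (b) vol(L_{1/2}) = (1 − 2^{n−1}/n!) · (1/2)^n. In particular, since the non-signaling slice at marginal t ≤ 1/2 is the cube [0,t]^{E(C_n)}, the initial volume ratio equals 1 − 1/(n−1)! on (0,1/3] and the middle ratio at t = 1/2 equals 1 − 2^{n−1}/n!. -/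
open MeasureTheory

noncomputable section

/-- The symmetric slice of the local polytope of the cycle graph `C_n` at marginal `t`. -/
def Lcyc (n : ℕ) (t : ℝ) : Set ((SimpleGraph.cycleGraph n).edgeSet → ℝ) :=
  {q | ((fun _ => t), q) ∈ cor (SimpleGraph.cycleGraph n)}


def vtxC {ι : Type} [DecidableEq ι] (Z : Finset ι) : ι → ℝ := fun i => if i ∈ Z then 0 else 1

def dstC {ι : Type} [Fintype ι] [DecidableEq ι] (Z : Finset ι) (y : ι → ℝ) : ℝ :=
  ∑ i, if i ∈ Z then y i else 1 - y i

theorem hullC {ι : Type} [Fintype ι] [DecidableEq ι] (S : Finset (Finset ι))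
    (hS : ∀ Z ∈ S, ∀ i, symmDiff Z {i} ∉ S) (y : ι → ℝ) (hy : ∀ i, 0 ≤ y i ∧ y i ≤ 1)
    (hd : ∀ Z ∈ S, 1 ≤ dstC Z y) :
    y ∈ convexHull ℝ (vtxC '' {Z : Finset ι | Z ∉ S}) := by
  by_contra hcon
  have hfin : (vtxC '' {Z : Finset ι | Z ∉ S}).Finite := Set.toFinite _
  obtain ⟨f, u, hfy, hfu⟩ := geometric_hahn_banach_point_closed (convex_convexHull ℝ _)
    (hfin.isClosed_convexHull (𝕜 := ℝ)) hcon
  have hlin : ∀ x : ι → ℝ, f x = ∑ i, f (Pi.single i 1) * x i := by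
    intro x
    conv_lhs => rw [pi_eq_sum_univ' x]
    rw [map_sum]
    refine Finset.sum_congr rfl fun i _ => ?_
    rw [map_smul, smul_eq_mul, mul_comm]
  set c : ι → ℝ := fun i => f (Pi.single i 1) with hc
  set V : Finset ι := Finset.univ.filter fun i => 0 ≤ c i with hV
  have key : ∀ x : ι → ℝ, f x - f (vtxC V) = ∑ i, |c i| * (if i ∈ V then x i else 1 - x i) := by
    intro x
    rw [hlin, hlin, ← Finset.sum_sub_distrib]
    refine Finset.sum_congr rfl fun i _ => ?_
    by_cases h : 0 ≤ c i
    · have : i ∈ V := by simp [hV, h]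
      simp only [vtxC, this, if_true, abs_of_nonneg h]
      simp [hc]
    · have : i ∉ V := by simp only [hV, Finset.mem_filter]; tauto
      simp only [vtxC, this, if_false, abs_of_neg (not_le.1 h)]
      simp only [hc]; ring
  have hnn : ∀ i, 0 ≤ (if i ∈ V then y i else 1 - y i) := by
    intro i
    split_ifs
    · exact (hy i).1
    · linarith [(hy i).2]
  by_cases hVS : V ∈ S
  · have h1 := hd V hVS
    have hne : (Finset.univ : Finset ι).Nonempty := by
      by_contra h
      rw [Finset.not_nonempty_iff_eq_empty] at h
      simp only [dstC, h, Finset.sum_empty] at h1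
      linarith
    obtain ⟨k, -, hk⟩ := Finset.exists_min_image Finset.univ (fun i => |c i|) hne
    have h2 : f (vtxC (symmDiff V {k})) - f (vtxC V) = |c k| := by
      rw [key, Finset.sum_eq_single k]
      · by_cases h : k ∈ V <;> simp [vtxC, Finset.mem_symmDiff, h]
      · intro b _ hb
        by_cases h : b ∈ V <;> simp [vtxC, Finset.mem_symmDiff, h, hb]
      · simp
    have h3 : |c k| ≤ f y - f (vtxC V) := by
      rw [key]
      calc |c k| ≤ |c k| * dstC V y := le_mul_of_one_le_right (abs_nonneg _) h1
        _ ≤ _ := by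
          rw [dstC, Finset.mul_sum]
          exact Finset.sum_le_sum fun i _ =>
            mul_le_mul_of_nonneg_right (hk i (Finset.mem_univ _)) (hnn i)
    have h4 := hfu (vtxC (symmDiff V {k})) (subset_convexHull ℝ _ ⟨_, hS V hVS k, rfl⟩)
    linarith
  · have h3 : 0 ≤ f y - f (vtxC V) := by
      rw [key]
      exact Finset.sum_nonneg fun i _ => mul_nonneg (abs_nonneg _) (hnn i)
    have h4 := hfu (vtxC V) (subset_convexHull ℝ _ ⟨_, hVS, rfl⟩)
    linarith

/-- corner set -/
def polyC {ι : Type} [Fintype ι] [DecidableEq ι] (S : Finset (Finset ι)) : Set (ι → ℝ) :=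
  {y | (∀ i, 0 ≤ y i ∧ y i ≤ 1) ∧ ∀ Z ∈ S, 1 ≤ dstC Z y}

/-- volume of the simplex at origin, via the l1 ball -/
theorem vol_simplexC {ι : Type} [Fintype ι] [DecidableEq ι] :
    volume {x : ι → ℝ | (∀ i, 0 ≤ x i) ∧ ∑ i, x i < 1}
      = ENNReal.ofReal (1 / (Fintype.card ι).factorial) := by
  set T : Set (ι → ℝ) := {x : ι → ℝ | (∀ i, 0 ≤ x i) ∧ ∑ i, x i < 1} with hT
  have hball := MeasureTheory.volume_sum_rpow_lt_one ι (le_refl (1:ℝ))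
  have hTm : MeasurableSet T := by
    rw [hT]
    measurability
  let σ : Finset ι → (ι → ℝ) → (ι → ℝ) := fun Z x i => if i ∈ Z then - x i else x i
  have hσ : ∀ Z, MeasurePreserving (σ Z) := by
    intro Z
    refine volume_preserving_pi (f := fun i (x : ℝ) => if i ∈ Z then - x else x) ?_
    intro i
    by_cases h : i ∈ Z
    · simpa [h] using Measure.measurePreserving_neg (volume : Measure ℝ)
    · simp only [h, if_false]; exact MeasurePreserving.id _
  let B : Finset ι → Set (ι → ℝ) := fun Z => σ Z ⁻¹' T
  have hB : ∀ Z, volume (B Z) = volume T := fun Z =>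
    (hσ Z).measure_preimage hTm.nullMeasurableSet
  have hBm : ∀ Z, MeasurableSet (B Z) := fun Z => (hσ Z).measurable hTm
  have hU : {x : ι → ℝ | ∑ i, |x i| ^ (1:ℝ) < 1} = ⋃ Z, B Z := by
    ext x
    simp only [Set.mem_ofPred_eq, Set.mem_iUnion, Real.rpow_one]
    constructor
    · intro h
      refine ⟨Finset.univ.filter fun i => x i < 0, ?_⟩
      have : σ (Finset.univ.filter fun i => x i < 0) x = fun i => |x i| := by
        ext i
        by_cases hi : x i < 0
        · simp [σ, hi, abs_of_neg hi]
        · simp [σ, hi, abs_of_nonneg (not_lt.1 hi)]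
      show σ _ x ∈ T
      rw [this]
      exact ⟨fun i => abs_nonneg _, h⟩
    · rintro ⟨Z, h1, h2⟩
      have : ∀ i, |x i| = σ Z x i := by
        intro i
        have := h1 i
        rw [← abs_of_nonneg this]
        simp only [σ]
        split_ifs <;> simp
      simpa [this] using h2
  have hdis : Pairwise (Function.onFun (AEDisjoint volume) B) := by
    intro Z W hZW
    obtain ⟨i, hi⟩ : ∃ i, ¬ (i ∈ Z ↔ i ∈ W) := by
      by_contra h
      push Not at h
      exact hZW (Finset.ext h)
    have h0 : volume {x : ι → ℝ | x i = 0} = 0 :=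
      Measure.pi_hyperplane (fun _ : ι => (volume : Measure ℝ)) i 0
    refine measure_mono_null ?_ h0
    rintro x ⟨hx, hx'⟩
    have h1 := hx.1 i
    have h2 := hx'.1 i
    simp only [σ] at h1 h2
    show x i = 0
    by_cases ha : i ∈ Z <;> by_cases hb : i ∈ W <;> simp [ha, hb] at h1 h2 hi <;> linarith
  rw [hU, measure_iUnion₀ hdis (fun Z => (hBm Z).nullMeasurableSet), tsum_fintype] at hball
  simp only [hB, Finset.sum_const, Finset.card_univ, Fintype.card_finset, nsmul_eq_mul] at hball
  have hg : Real.Gamma ((Fintype.card ι : ℝ) / 1 + 1) = (Fintype.card ι).factorial := by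
    rw [div_one, Real.Gamma_nat_eq_factorial]
  have hg2 : Real.Gamma (1 / 1 + 1) = 1 := by
    have := Real.Gamma_nat_eq_factorial 1
    norm_num at this ⊢
  rw [hg, hg2] at hball
  have h2 : ENNReal.ofReal ((2 * 1) ^ Fintype.card ι / ((Fintype.card ι).factorial : ℝ))
      = ((2 ^ Fintype.card ι : ℕ) : ENNReal) *
        ENNReal.ofReal (1 / (Fintype.card ι).factorial) := by
    rw [← ENNReal.ofReal_natCast, ← ENNReal.ofReal_mul (by positivity)]
    congr 1
    push_cast
    ring
  rw [h2] at hball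
  exact (ENNReal.mul_right_inj (by simp) (by simp)).1 hball

theorem vol_polyC {ι : Type} [Fintype ι] [DecidableEq ι] (S : Finset (Finset ι))
    (hS : ∀ Z ∈ S, ∀ i, symmDiff Z {i} ∉ S) :
    volume (polyC S) = ENNReal.ofReal (1 - S.card / (Fintype.card ι).factorial) := by
  let Q : Set (ι → ℝ) := Set.Icc 0 1
  let T : Set (ι → ℝ) := {x : ι → ℝ | (∀ i, 0 ≤ x i) ∧ ∑ i, x i < 1}
  have hTm : MeasurableSet T := by
    show MeasurableSet {x : ι → ℝ | (∀ i, 0 ≤ x i) ∧ ∑ i, x i < 1}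
    measurability
  let σ : Finset ι → (ι → ℝ) → (ι → ℝ) := fun Z x i => if i ∈ Z then x i else 1 - x i
  have hσ : ∀ Z, MeasurePreserving (σ Z) := by
    intro Z
    refine volume_preserving_pi (f := fun i (x : ℝ) => if i ∈ Z then x else 1 - x) ?_
    intro i
    by_cases h : i ∈ Z
    · simp only [h, if_true]; exact MeasurePreserving.id _
    · simpa [h] using Measure.measurePreserving_sub_left (volume : Measure ℝ) 1
  let B : Finset ι → Set (ι → ℝ) := fun Z => σ Z ⁻¹' T
  have hB : ∀ Z, volume (B Z) = ENNReal.ofReal (1 / (Fintype.card ι).factorial) := fun Z => by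
    rw [← vol_simplexC]
    exact (hσ Z).measure_preimage hTm.nullMeasurableSet
  have hBm : ∀ Z, MeasurableSet (B Z) := fun Z => (hσ Z).measurable hTm
  have hBQ : ∀ Z, ∀ y, y ∈ B Z ↔ (∀ i, 0 ≤ y i ∧ y i ≤ 1) ∧ dstC Z y < 1 := by
    intro Z y
    constructor
    · rintro ⟨h1, h2⟩
      refine ⟨fun i => ?_, h2⟩
      have h3 := h1 i
      have h4 : σ Z y i ≤ 1 :=
        (Finset.single_le_sum (fun j _ => h1 j) (Finset.mem_univ i)).trans h2.le
      simp only [σ] at h3 h4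
      split_ifs at h3 h4 <;> constructor <;> linarith
    · rintro ⟨h1, h2⟩
      refine ⟨fun i => ?_, h2⟩
      have := h1 i
      simp only [σ]
      split_ifs <;> linarith
  have hdis : (S : Set (Finset ι)).PairwiseDisjoint B := by
    intro Z hZ W hW hZW
    rw [Function.onFun, Set.disjoint_left]
    intro y hyZ hyW
    rw [hBQ] at hyZ hyW
    obtain ⟨i, hi⟩ : ∃ i, ¬ (i ∈ Z ↔ i ∈ W) := by
      by_contra h
      push Not at h
      exact hZW (Finset.ext h)
    obtain ⟨j, hji, hj⟩ : ∃ j, j ≠ i ∧ ¬ (j ∈ Z ↔ j ∈ W) := by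
      by_contra h
      push Not at h
      refine hS Z hZ i ?_
      have : symmDiff Z {i} = W := by
        ext j
        by_cases hji : j = i
        · subst hji
          simp [Finset.mem_symmDiff]; tauto
        · simp [Finset.mem_symmDiff, hji, h j hji]
      rwa [this]
    have h1 : dstC Z y + dstC W y = ∑ i, ((if i ∈ Z then y i else 1 - y i) +
        (if i ∈ W then y i else 1 - y i)) := by
      rw [dstC, dstC, ← Finset.sum_add_distrib]
    have hnn : ∀ i, 0 ≤ ((if i ∈ Z then y i else 1 - y i) +
        (if i ∈ W then y i else 1 - y i)) := by
      intro i
      have := hyZ.1 i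
      split_ifs <;> linarith
    have hone : ∀ i, ¬ (i ∈ Z ↔ i ∈ W) → ((if i ∈ Z then y i else 1 - y i) +
        (if i ∈ W then y i else 1 - y i)) = 1 := by
      intro i hi
      by_cases ha : i ∈ Z <;> by_cases hb : i ∈ W <;> simp [ha, hb] at hi ⊢
    have h2 := Finset.sum_le_univ_sum_of_nonneg (s := {j, i}) hnn
    rw [Finset.sum_pair hji, hone i hi, hone j hj, ← h1] at h2
    linarith [hyZ.2, hyW.2]
  have hP : polyC S = Q \ ⋃ Z ∈ S, B Z := by
    ext y
    simp only [polyC, Set.mem_ofPred_eq, Set.mem_sdiff, Set.mem_iUnion, hBQ, Q, Set.mem_Icc,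
      Pi.le_def, Pi.zero_apply, Pi.one_apply, ← forall_and]
    refine and_congr_right fun h => ?_
    push Not
    exact ⟨fun h' Z hZ _ => h' Z hZ, fun h' Z hZ => h' Z hZ h⟩
  have hvU : volume (⋃ Z ∈ S, B Z) = ENNReal.ofReal (S.card / (Fintype.card ι).factorial) := by
    rw [measure_biUnion_finset hdis (fun Z _ => hBm Z)]
    simp only [hB, Finset.sum_const, nsmul_eq_mul]
    rw [← ENNReal.ofReal_natCast, ← ENNReal.ofReal_mul (by positivity)]
    congr 1
    ring
  have hQ : volume Q = 1 := by
    simp [Q, Real.volume_Icc_pi]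
  rw [hP, measure_sdiff _ (Finset.measurableSet_biUnion _ fun Z _ => hBm Z).nullMeasurableSet
    (by rw [hvU]; exact ENNReal.ofReal_ne_top), hvU, hQ, ENNReal.ofReal_sub _ (by positivity),
    ENNReal.ofReal_one]
  intro y hy
  simp only [Set.mem_iUnion, hBQ] at hy
  obtain ⟨Z, _, h, _⟩ := hy
  exact ⟨fun i => (h i).1, fun i => (h i).2⟩

def edgeMapC (m : ℕ) (i : Fin (m + 3)) : (SimpleGraph.cycleGraph (m + 3)).edgeSet :=
  ⟨s(i, i + 1), by
    rw [SimpleGraph.mem_edgeSet, SimpleGraph.cycleGraph_adj]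
    right; simp⟩

theorem edgeMapC_bij (m : ℕ) : Function.Bijective (edgeMapC m) := by
  constructor
  · intro i j h
    have h' : s(i, i + 1) = s(j, j + 1) := congrArg Subtype.val h
    rw [Sym2.eq_iff] at h'
    rcases h' with ⟨h1, _⟩ | ⟨h1, h2⟩
    · exact h1
    · exfalso
      rw [h1, add_assoc] at h2
      have h3 : (1 + 1 : Fin (m + 3)) = 0 := by simpa using h2
      have h4 := congrArg Fin.val h3
      simp [Fin.val_add] at h4
      rw [Nat.mod_eq_of_lt (by omega)] at h4
      omega
  · rintro ⟨e, he⟩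
    induction e using Sym2.ind with
    | _ u v =>
      have he' := he
      rw [SimpleGraph.mem_edgeSet, SimpleGraph.cycleGraph_adj] at he'
      rcases he' with h | h
      · refine ⟨v, Subtype.ext ?_⟩
        have : u = v + 1 := sub_eq_iff_eq_add'.1 h
        simp only [edgeMapC]
        rw [this, Sym2.eq_swap]
      · refine ⟨u, Subtype.ext ?_⟩
        have : v = u + 1 := sub_eq_iff_eq_add'.1 h
        simp only [edgeMapC]
        rw [this]

def edgeEquivC (m : ℕ) : Fin (m + 3) ≃ (SimpleGraph.cycleGraph (m + 3)).edgeSet :=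
  Equiv.ofBijective _ (edgeMapC_bij m)

theorem corPoint_edgeC (m : ℕ) (f : Fin (m + 3) → Bool) (i : Fin (m + 3)) :
    (corPoint (SimpleGraph.cycleGraph (m + 3)) f).2 (edgeEquivC m i)
      = (if f i then (1 : ℝ) else 0) * (if f (i + 1) then 1 else 0) := rfl

theorem even_cutC (m : ℕ) (f : Fin (m + 3) → Bool) :
    Even (Finset.univ.filter fun i => f i ≠ f (i + 1)).card := by
  have h1 : ∏ i : Fin (m + 3), ((if f i then (-1 : ℤ) else 1) * (if f (i + 1) then (-1 : ℤ) else 1))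
      = 1 := by
    have h0 : (∏ i : Fin (m + 3), (if f (i + 1) then (-1 : ℤ) else 1))
        = ∏ i : Fin (m + 3), (if f i then (-1 : ℤ) else 1) :=
      Equiv.prod_comp (Equiv.addRight (1 : Fin (m + 3))) (fun i => if f i then (-1 : ℤ) else 1)
    rw [Finset.prod_mul_distrib, h0, ← Finset.prod_mul_distrib]
    apply Finset.prod_eq_one
    intro i _
    split_ifs <;> norm_num
  have h2 : ∏ i : Fin (m + 3), ((if f i then (-1 : ℤ) else 1) * (if f (i + 1) then (-1 : ℤ) else 1))
      = (-1) ^ (Finset.univ.filter fun i => f i ≠ f (i + 1)).card := by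
    rw [← Finset.prod_const, Finset.prod_filter]
    refine Finset.prod_congr rfl fun i _ => ?_
    cases f i <;> cases f (i + 1) <;> simp
  rw [h1] at h2
  exact (neg_one_pow_eq_one_iff_even (by norm_num)).1 h2.symm

/-- the (rim) cut coordinate -/
def cutC (m : ℕ) (x : (Fin (m + 3) → ℝ) × ((SimpleGraph.cycleGraph (m + 3)).edgeSet → ℝ))
    (i : Fin (m + 3)) : ℝ := x.1 i + x.1 (i + 1) - 2 * x.2 (edgeEquivC m i)

theorem cor_sub1C (m : ℕ) (x) (hx : x ∈ cor (SimpleGraph.cycleGraph (m + 3))) (i : Fin (m + 3)) :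
    0 ≤ x.2 (edgeEquivC m i) ∧ x.2 (edgeEquivC m i) ≤ x.1 i := by
  have : cor (SimpleGraph.cycleGraph (m + 3)) ⊆
      {x | 0 ≤ x.2 (edgeEquivC m i) ∧ x.2 (edgeEquivC m i) ≤ x.1 i} := by
    refine convexHull_min ?_ ?_
    · rintro _ ⟨f, rfl⟩
      show 0 ≤ _ ∧ _ ≤ _
      rw [corPoint_edgeC]
      simp only [corPoint]
      split_ifs <;> norm_num
    · rintro x ⟨hx1, hx2⟩ y ⟨hy1, hy2⟩ a b ha hb hab
      show 0 ≤ a * _ + b * _ ∧ a * _ + b * _ ≤ a * _ + b * _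
      constructor
      · positivity
      · gcongr
  exact this hx

theorem cor_sub2C (m : ℕ) (x) (hx : x ∈ cor (SimpleGraph.cycleGraph (m + 3)))
    (Z : Finset (Fin (m + 3))) (hZ : Odd Z.card) :
    1 ≤ ∑ i, if i ∈ Z then 1 - cutC m x i else cutC m x i := by
  have : cor (SimpleGraph.cycleGraph (m + 3)) ⊆
      {x | 1 ≤ ∑ i, if i ∈ Z then 1 - cutC m x i else cutC m x i} := by
    refine convexHull_min ?_ ?_
    · rintro _ ⟨f, rfl⟩
      rw [Set.mem_ofPred_eq]
      have hcut : ∀ i, cutC m (corPoint _ f) i = if f i ≠ f (i + 1) then 1 else 0 := by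
        intro i
        rw [cutC, corPoint_edgeC]
        simp only [corPoint]
        cases f i <;> cases f (i + 1) <;> norm_num
      have hne : Z ≠ Finset.univ.filter fun i => f i ≠ f (i + 1) := by
        intro h
        have := even_cutC m f
        rw [← h] at this
        exact (Nat.not_even_iff_odd.2 hZ) this
      obtain ⟨i, hi⟩ : ∃ i, ¬ (i ∈ Z ↔ f i ≠ f (i + 1)) := by
        by_contra h
        push Not at h
        apply hne
        ext i
        simpa using h i
      have hnn : ∀ i, 0 ≤ (if i ∈ Z then 1 - cutC m (corPoint _ f) i
          else cutC m (corPoint _ f) i) := by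
        intro i
        rw [hcut]
        split_ifs <;> norm_num
      refine le_trans (le_of_eq ?_) (Finset.single_le_sum (fun j _ => hnn j) (Finset.mem_univ i))
      rw [hcut]
      by_cases ha : i ∈ Z <;> by_cases hb : f i = f (i + 1) <;> simp [ha, hb] at hi ⊢
    · intro x hx y hy a b ha hb hab
      have hx' : 1 ≤ ∑ i, if i ∈ Z then 1 - cutC m x i else cutC m x i := hx
      have hy' : 1 ≤ ∑ i, if i ∈ Z then 1 - cutC m y i else cutC m y i := hy
      rw [Set.mem_ofPred_eq]
      have : (∑ i, if i ∈ Z then 1 - cutC m (a • x + b • y) i else cutC m (a • x + b • y) i)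
          = a * (∑ i, if i ∈ Z then 1 - cutC m x i else cutC m x i)
            + b * (∑ i, if i ∈ Z then 1 - cutC m y i else cutC m y i) := by
        rw [Finset.mul_sum, Finset.mul_sum, ← Finset.sum_add_distrib]
        refine Finset.sum_congr rfl fun i _ => ?_
        have h : cutC m (a • x + b • y) i = a * cutC m x i + b * cutC m y i := by
          simp only [cutC, Prod.fst_add, Prod.snd_add, Prod.smul_fst, Prod.smul_snd, Pi.add_apply,
            Pi.smul_apply, smul_eq_mul]
          ring
        rw [h]
        split_ifs
        · linear_combination -hab
        · ring
      rw [this]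
      nlinarith
  exact this hx

theorem colorC (m K : ℕ) (Z : Finset (Fin (m + 3))) (g : ℕ → Fin K) (hk : g Z.card = g 0)
    (hg : ∀ a < Z.card, g a ≠ g (a + 1)) :
    ∃ c : Fin (m + 3) → Fin K, ∀ i, i ∈ Z ↔ c i ≠ c (i + 1) := by
  let N : ℕ → ℕ := fun a => (Z.filter fun j => j.val < a).card
  have hN0 : N 0 = 0 := by simp [N]
  have hNn : N (m + 3) = Z.card := by
    simp [N, Finset.filter_true_of_mem]
  have hNs : ∀ i : Fin (m + 3), N (i.val + 1) = N i.val + if i ∈ Z then 1 else 0 := by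
    intro i
    by_cases h : i ∈ Z
    · have : (Z.filter fun j => j.val < i.val + 1) = insert i (Z.filter fun j => j.val < i.val) := by
        ext j
        simp only [Finset.mem_filter, Finset.mem_insert, Fin.ext_iff]
        constructor
        · rintro ⟨h1, h2⟩
          by_cases h3 : j.val = i.val
          · exact Or.inl h3
          · exact Or.inr ⟨h1, by omega⟩
        · rintro (h1 | ⟨h1, h2⟩)
          · rw [Fin.ext h1]; exact ⟨h, by omega⟩
          · exact ⟨h1, by omega⟩
      simp only [N, this, h, if_true]
      rw [Finset.card_insert_of_notMem (by simp)]
    · simp only [N, h, if_false, add_zero]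
      congr 1
      ext j
      simp only [Finset.mem_filter]
      refine and_congr_right fun h1 => ?_
      have : j.val ≠ i.val := fun h2 => h (Fin.ext h2 ▸ h1)
      omega
  have hc : ∀ i : Fin (m + 3), g (N (i + 1 : Fin (m + 3)).val) = g (N (i.val + 1)) := by
    intro i
    by_cases h : i.val + 1 < m + 3
    · congr 2
      rw [Fin.val_add, Fin.val_one, Nat.mod_eq_of_lt h]
    · have h1 : i.val + 1 = m + 3 := by omega
      have h2 : (i + 1 : Fin (m + 3)).val = 0 := by
        rw [Fin.val_add, Fin.val_one, h1, Nat.mod_self]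
      rw [h1, h2, hN0, hNn, hk]
  refine ⟨fun i => g (N i.val), fun i => ?_⟩
  simp only []
  rw [hc, hNs]
  by_cases h : i ∈ Z
  · simp only [h, if_true, true_iff]
    apply hg
    have h1 := hNs i
    have h2 : N (i.val + 1) ≤ Z.card := Finset.card_filter_le _ _
    simp only [h, if_true] at h1
    omega
  · simp [h]

theorem vertex_memC (m K : ℕ) (t : ℝ) (ht : 0 ≤ t) (hK : K * t ≤ 1) (Z : Finset (Fin (m + 3)))
    (c : Fin (m + 3) → Fin K) (hc : ∀ i, i ∈ Z ↔ c i ≠ c (i + 1)) :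
    ((fun _ => t), fun e => t * vtxC Z ((edgeEquivC m).symm e))
      ∈ cor (SimpleGraph.cycleGraph (m + 3)) := by
  let w : Option (Fin K) → ℝ := fun o => o.elim (1 - K * t) (fun _ => t)
  let F : Option (Fin K) → Fin (m + 3) → Bool := fun o i => o.elim false (fun k => c i = k)
  have := (convex_convexHull ℝ (Set.range (corPoint (SimpleGraph.cycleGraph (m + 3))))).sum_mem
    (t := Finset.univ) (w := w) (z := fun o => corPoint _ (F o)) ?_ ?_ ?_
  · convert! this using 1
    refine Prod.ext ?_ ?_
    · ext i
      simp [Prod.fst_sum, w, F, corPoint, Fintype.sum_option]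
    · ext e
      obtain ⟨i, rfl⟩ := (edgeEquivC m).surjective e
      rw [Prod.snd_sum, Finset.sum_apply]
      simp only [Prod.smul_snd, Pi.smul_apply, corPoint_edgeC,
        Fintype.sum_option, Equiv.symm_apply_apply, vtxC, hc, smul_eq_mul]
      by_cases h : c i = c (i + 1)
      · simp [w, F, h]
      · simp only [w, F, h]
        simp
  · rintro (_ | k) _
    · simp only [w, Option.elim]; linarith
    · exact ht
  · simp [w, Fintype.sum_option]
  · exact fun o _ => subset_convexHull ℝ _ ⟨_, rfl⟩

open scoped Pointwise in
/-- Main geometric reduction. -/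
theorem Lcyc_volC (m : ℕ) (t : ℝ) (ht : 0 < t) (S : Finset (Finset (Fin (m + 3))))
    (hS : ∀ Z ∈ S, ∀ i, symmDiff Z {i} ∉ S) (K : ℕ) (hK : K * t ≤ 1)
    (hcol : ∀ Z ∉ S, ∃ c : Fin (m + 3) → Fin K, ∀ i, i ∈ Z ↔ c i ≠ c (i + 1))
    (hnec : ∀ y : Fin (m + 3) → ℝ,
      ((fun _ => t), fun e => t * y ((edgeEquivC m).symm e))
        ∈ cor (SimpleGraph.cycleGraph (m + 3)) → ∀ Z ∈ S, 1 ≤ dstC Z y) :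
    volume (Lcyc (m + 3) t) =
      ENNReal.ofReal ((1 - S.card / (m + 3).factorial) * t ^ (m + 3)) := by
  have hiff : ∀ y : Fin (m + 3) → ℝ, ((fun _ => t), fun e => t * y ((edgeEquivC m).symm e))
        ∈ cor (SimpleGraph.cycleGraph (m + 3)) ↔ y ∈ polyC S := by
    intro y
    constructor
    · intro h
      refine ⟨fun i => ?_, hnec y h⟩
      have := cor_sub1C m _ h i
      simp only [Equiv.symm_apply_apply] at this
      constructor
      · exact nonneg_of_mul_nonneg_right this.1 ht
      · nlinarith [this.2]
    · rintro ⟨h1, h2⟩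
      have hh := hullC S hS y h1 h2
      have hsub : convexHull ℝ (vtxC '' {Z : Finset (Fin (m + 3)) | Z ∉ S}) ⊆
          {y | ((fun _ => t), fun e => t * y ((edgeEquivC m).symm e))
            ∈ cor (SimpleGraph.cycleGraph (m + 3))} := by
        refine convexHull_min ?_ ?_
        · rintro _ ⟨Z, hZ, rfl⟩
          obtain ⟨c, hc⟩ := hcol Z hZ
          exact vertex_memC m K t ht.le hK Z c hc
        · intro x hx y hy a b ha hb hab
          have := convex_convexHull ℝ _ hx hy ha hb hab
          show _ ∈ convexHull ℝ _
          convert! this using 1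
          refine Prod.ext ?_ ?_
          · ext i
            simp only [Prod.fst_add, Prod.smul_fst, Pi.add_apply, Pi.smul_apply, smul_eq_mul]
            linear_combination -t * hab
          · ext e
            simp only [Prod.snd_add, Prod.smul_snd, Pi.add_apply, Pi.smul_apply, smul_eq_mul]
            ring
      exact hsub hh
  have hmp := volume_measurePreserving_piCongrLeft (fun _ => ℝ) (edgeEquivC m)
  have hpre : (MeasurableEquiv.piCongrLeft (fun _ => ℝ) (edgeEquivC m)) ⁻¹' (Lcyc (m + 3) t)
      = t • polyC S := by
    ext q
    rw [Set.mem_smul_set_iff_inv_smul_mem₀ ht.ne', ← hiff]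
    show _ ∈ cor _ ↔ _
    have : (MeasurableEquiv.piCongrLeft (fun _ => ℝ) (edgeEquivC m)) q
        = fun e => t * (t⁻¹ • q) ((edgeEquivC m).symm e) := by
      ext e
      obtain ⟨i, rfl⟩ := (edgeEquivC m).surjective e
      rw [MeasurableEquiv.coe_piCongrLeft, Equiv.piCongrLeft_apply_apply]
      simp [ht.ne']
    rw [this]
  have hv := hmp.measure_preimage_equiv (Lcyc (m + 3) t)
  rw [hpre, Measure.addHaar_smul, vol_polyC S hS] at hv
  rw [← hv, ← ENNReal.ofReal_mul (abs_nonneg _)]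
  congr 1
  rw [abs_of_nonneg (by positivity)]
  simp
  ring

theorem card_oddC (m : ℕ) :
    ((Finset.univ : Finset (Finset (Fin (m + 3)))).filter fun Z => Odd Z.card).card
      = 2 ^ (m + 2) := by
  have h := Finset.sum_powerset_neg_one_pow_card_of_nonempty
    (x := (Finset.univ : Finset (Fin (m + 3)))) Finset.univ_nonempty
  rw [Finset.powerset_univ] at h
  have h1 : ∀ Z : Finset (Fin (m + 3)), (-1 : ℤ) ^ Z.card = 1 - 2 * (if Odd Z.card then 1 else 0) := by
    intro Z
    split_ifs with h
    · rw [h.neg_one_pow]; norm_num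
    · rw [(Nat.not_odd_iff_even.1 h).neg_one_pow]; norm_num
  simp only [h1] at h
  rw [Finset.sum_sub_distrib, ← Finset.mul_sum, Finset.sum_boole] at h
  simp only [Finset.sum_const, Finset.card_univ, Fintype.card_finset, Fintype.card_fin] at h
  have h2 : (2 : ℤ) ^ (m + 3) = 2 * 2 ^ (m + 2) := by ring
  simp only [nsmul_eq_mul, mul_one] at h
  push_cast at h
  have : (((Finset.univ : Finset (Finset (Fin (m + 3)))).filter fun Z => Odd Z.card).card : ℤ)
      = 2 ^ (m + 2) := by linarith
  exact_mod_cast this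

theorem card_symmDiffC {ι : Type} [DecidableEq ι] (Z : Finset ι) (i : ι) :
    (symmDiff Z {i}).card + 1 = Z.card ∨ (symmDiff Z {i}).card = Z.card + 1 := by
  by_cases h : i ∈ Z
  · left
    have : symmDiff Z {i} = Z.erase i := by
      ext j
      by_cases hj : j = i <;> simp [Finset.mem_symmDiff, hj, h]
    rw [this, Finset.card_erase_add_one h]
  · right
    have : symmDiff Z {i} = insert i Z := by
      ext j
      by_cases hj : j = i <;> simp [Finset.mem_symmDiff, hj, h]
    rw [this, Finset.card_insert_of_notMem h]

/-- For the cycle graph `C_n` (`n ≥ 3`) with symmetric marginals: (a) for `0 < t ≤ 1/3`, the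
volume of the local slice equals `(1 - 1/(n-1)!) · tⁿ`, so, the non-signaling slice being the
cube `[0,t]ⁿ`, the initial volume ratio is `1 - 1/(n-1)!`; (b) at `t = 1/2` the volume equals
`(1 - 2^(n-1)/n!) · (1/2)ⁿ`, so the middle ratio is `1 - 2^(n-1)/n!`. -/
theorem stmt13 (n : ℕ) (hn : 3 ≤ n) :
    (∀ t : ℝ, 0 < t → t ≤ 1 / 3 →
        volume (Lcyc n t) =
          ENNReal.ofReal ((1 - 1 / (n - 1).factorial) * t ^ n)) ∧
    volume (Lcyc n (1 / 2)) =
      ENNReal.ofReal ((1 - 2 ^ (n - 1) / n.factorial) * (1 / 2) ^ n) := by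
  obtain ⟨m, rfl⟩ : ∃ m, n = m + 3 := ⟨n - 3, by omega⟩
  have hcut : ∀ (t : ℝ) (y : Fin (m + 3) → ℝ) (i : Fin (m + 3)),
      cutC m ((fun _ => t), fun e => t * y ((edgeEquivC m).symm e)) i = 2 * t * (1 - y i) := by
    intro t y i
    simp only [cutC, Equiv.symm_apply_apply]
    ring
  constructor
  · intro t ht0 ht
    rw [Lcyc_volC m t ht0 (Finset.univ.filter fun Z => Z.card = 1) ?_ 3 ?_ ?_ ?_]
    · congr 3
      have : (Finset.univ.filter fun Z : Finset (Fin (m + 3)) => Z.card = 1).card = m + 3 := by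
        rw [Finset.univ_filter_card_eq, Finset.card_powersetCard]
        simp
      rw [this, show m + 3 - 1 = m + 2 by omega, Nat.factorial_succ]
      have : ((m + 2).factorial : ℝ) ≠ 0 := by positivity
      push_cast
      field_simp
      norm_num
      try ring
    · intro Z hZ i
      have := card_symmDiffC Z i
      simp at hZ ⊢
      omega
    · norm_num; linarith
    · intro Z hZ
      simp at hZ
      refine colorC m 3 Z (fun a => if a = Z.card then 0 else if a + 1 = Z.card then 2 else
        if a % 2 = 0 then 0 else 1) ?_ ?_
      · by_cases h0 : Z.card = 0
        · simp [h0]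
        · have : ¬ (1 = Z.card) := fun h => hZ h.symm
          have h0' : ¬ (0 = Z.card) := fun h => h0 h.symm
          simp [this, h0']
      · intro a ha
        split_ifs <;> first | omega | decide
    · intro y hy Z hZ
      simp only [Finset.mem_filter, Finset.mem_univ, true_and] at hZ
      have h := cor_sub2C m _ hy Z (by rw [hZ]; decide)
      simp only [hcut] at h
      have h2 : (∑ i, if i ∈ Z then 1 - 2 * t * (1 - y i) else 2 * t * (1 - y i))
          = 2 * t * dstC Z y + (1 - 2 * t) := by
        have h3 : (1 - 2 * t) = ∑ i, if i ∈ Z then 1 - 2 * t else 0 := by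
          rw [Finset.sum_ite_mem, Finset.univ_inter, Finset.sum_const, hZ, one_smul]
        rw [h3, dstC, Finset.mul_sum, ← Finset.sum_add_distrib]
        refine Finset.sum_congr rfl fun i _ => ?_
        split_ifs <;> ring
      rw [h2] at h
      nlinarith
  · rw [Lcyc_volC m (1 / 2) (by norm_num) (Finset.univ.filter fun Z => Odd Z.card) ?_ 2 ?_ ?_ ?_]
    · rw [card_oddC, show m + 3 - 1 = m + 2 by omega]
      push_cast
      rfl
    · intro Z hZ i
      have := card_symmDiffC Z i
      simp [Nat.odd_iff] at hZ ⊢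
      omega
    · norm_num
    · intro Z hZ
      simp [Nat.even_iff] at hZ
      refine colorC m 2 Z (fun a => if a % 2 = 0 then 0 else 1) ?_ ?_
      · simp [hZ]
      · intro a ha
        split_ifs <;> first | omega | decide
    · intro y hy Z hZ
      simp only [Finset.mem_filter, Finset.mem_univ, true_and] at hZ
      have h := cor_sub2C m _ hy Z hZ
      simp only [hcut] at h
      refine h.trans (le_of_eq ?_)
      rw [dstC]
      refine Finset.sum_congr rfl fun i _ => ?_
      split_ifs <;> ring
end
end
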